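/- Let T be a densely defined self-adjoint operator on a complex Hilbert space H with bounded transform S, σ̃(S) = σ(S) ∩ (-1,1), and u(x) = x(1 - x²)^{-1/2}. The map f ↦ f(T) := (f∘u)(S) is an isometric *-homomorphism from C₀(σ(T)) (with supremum norm) into the unital C*-algebra C*(S) generated by S, with image C*₀(S) = { g(S) : g ∈ C₀(σ̃(S)) }. -/

import Mathlib

noncomputable section

variable {H : Type*} [NormedAddCommGroup H] [InnerProductSpace ℂ H] [CompleteSpace H]

/-- `S = T(I + T²)^{-1/2}`, the *bounded transform* of the (possibly unbounded) operator `T`.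
This is witnessed by `C = (I + T²)⁻¹` (a positive bounded operator mapping into the domain of
`T²` with `(I + T²) ∘ C = I`, which determines `C` uniquely when `T` is self-adjoint) together
with its (unique) positive square root `R = (I + T²)^{-1/2}`, and `S = T ∘ R`. -/
def IsBoundedTransform (T : H →ₗ.[ℂ] H) (S : H →L[ℂ] H) : Prop :=
  ∃ C R : H →L[ℂ] H, C.IsPositive ∧ R.IsPositive ∧ R * R = C ∧
    (∀ x : H, ∃ (h1 : C x ∈ T.domain) (h2 : (T ⟨C x, h1⟩ : H) ∈ T.domain),
        C x + T ⟨(T ⟨C x, h1⟩ : H), h2⟩ = x) ∧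
    (∀ x : H, ∃ hx : R x ∈ T.domain, S x = T ⟨R x, hx⟩)

/-- `S` is a pure contraction: `‖Sx‖ < ‖x‖` for all `x ≠ 0`. -/
def PureContraction (S : H →L[ℂ] H) : Prop := ∀ x : H, x ≠ 0 → ‖S x‖ < ‖x‖

/-- `T = S(I - S²)^{-1/2}`: witnessed by the (unique) positive square root `R` of `I - S²`,
with `D(T) = ran R` and `T ∘ R = S`. -/
def IsInverseBoundedTransform (S : H →L[ℂ] H) (T : H →ₗ.[ℂ] H) : Prop :=
  ∃ R : H →L[ℂ] H, R.IsPositive ∧ R * R = 1 - S * S ∧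
    (T.domain : Set H) = Set.range R ∧
    (∀ x : H, ∃ hx : R x ∈ T.domain, (T ⟨R x, hx⟩ : H) = S x)

/-- The resolvent set of an unbounded operator: `z` such that `T - z` has a (bounded,
everywhere defined) two-sided inverse. -/
def pmapResolventSet (T : H →ₗ.[ℂ] H) : Set ℂ :=
  {z | ∃ B : H →L[ℂ] H,
    (∀ x : H, ∃ h : B x ∈ T.domain, (T ⟨B x, h⟩ : H) - z • B x = x) ∧
    (∀ ψ : T.domain, B ((T ψ : H) - z • (ψ : H)) = ψ)}

/-- The spectrum of an unbounded operator. -/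
def pmapSpectrum (T : H →ₗ.[ℂ] H) : Set ℂ := (pmapResolventSet T)ᶜ

/-- The real points of the spectrum of `T` (all of them, if `T` is self-adjoint). -/
def realSpec (T : H →ₗ.[ℂ] H) : Set ℝ := {x : ℝ | (x : ℂ) ∈ pmapSpectrum T}

/-- `g(S)` for a function `g : ℝ → ℂ`, via the continuous functional calculus of `S`. -/
def boundedCalc (S : H →L[ℂ] H) (g : ℝ → ℂ) : H →L[ℂ] H :=
  cfc (fun z : ℂ => g z.re) S

/-- The homeomorphism `u : (-1,1) → ℝ`, `u(x) = x(1 - x²)^{-1/2}`. -/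
def uFun : ℝ → ℝ := fun x => x / Real.sqrt (1 - x ^ 2)

/-- `h ∘ u`, extended by `0` outside `(-1,1)`. -/
def compU (h : ℝ → ℂ) : ℝ → ℂ :=
  fun x => if x ∈ Set.Ioo (-1 : ℝ) 1 then h (uFun x) else 0

/-- `h(T) := (h ∘ u)(S)`, for a function `h` on `σ(T)`, where `S` is the bounded
transform of `T`. -/
def pmapCalc (S : H →L[ℂ] H) (h : ℝ → ℂ) : H →L[ℂ] H := boundedCalc S (compU h)

/-- `σ̃(S) = σ(S) ∩ (-1,1)`. -/
def tildeSpec (S : H →L[ℂ] H) : Set ℝ := spectrum ℝ S ∩ Set.Ioo (-1) 1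

/-- `g ∈ C_c(Ω)`: continuous on `Ω`, vanishing outside a compact subset of `Ω`
(functions on `Ω` are encoded as functions on `ℝ` vanishing identically outside `Ω`). -/
def MemCc (g : ℝ → ℂ) (Ω : Set ℝ) : Prop :=
  ContinuousOn g Ω ∧ ∃ K : Set ℝ, IsCompact K ∧ K ⊆ Ω ∧ ∀ x ∉ K, g x = 0

/-- `g ∈ C₀(Ω)`: continuous on `Ω` and vanishing at infinity on `Ω`. -/
def MemC0 (g : ℝ → ℂ) (Ω : Set ℝ) : Prop :=
  ContinuousOn g Ω ∧ (∀ x ∉ Ω, g x = 0) ∧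
    ∀ ε > 0, ∃ K : Set ℝ, IsCompact K ∧ K ⊆ Ω ∧ ∀ x ∈ Ω \ K, ‖g x‖ < ε

/-- `g ∈ C_b(Ω)`: continuous and bounded on `Ω`. -/
def MemCb (g : ℝ → ℂ) (Ω : Set ℝ) : Prop :=
  ContinuousOn g Ω ∧ ∃ M : ℝ, ∀ x ∈ Ω, ‖g x‖ ≤ M

/-- The supremum norm `‖f‖_∞` of `f` over `Ω`. -/
def supNorm (f : ℝ → ℂ) (Ω : Set ℝ) : ℝ := sSup ((fun x => ‖f x‖) '' Ω)

/-- The subspace `C*_c(S)H`: the linear span of all `g(S)ψ` with `g ∈ C_c(σ̃(S))`. -/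
def ccSpan (S : H →L[ℂ] H) : Submodule ℂ H :=
  Submodule.span ℂ
    {v : H | ∃ g : ℝ → ℂ, MemCc g (tildeSpec S) ∧ ∃ ψ : H, v = boundedCalc S g ψ}

/-- The subspace `C*₀(S)H`: the linear span of all `g(S)ψ` with `g ∈ C₀(σ̃(S))`. -/
def c0Span (S : H →L[ℂ] H) : Submodule ℂ H :=
  Submodule.span ℂ
    {v : H | ∃ g : ℝ → ℂ, MemC0 g (tildeSpec S) ∧ ∃ ψ : H, v = boundedCalc S g ψ}

/-- `TR ⊂ RT`: the bounded operator `R` commutes with the unbounded operator `T`. -/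
def CommutesPMap (T : H →ₗ.[ℂ] H) (R : H →L[ℂ] H) : Prop :=
  ∀ ψ : T.domain, ∃ h : R (ψ : H) ∈ T.domain, (T ⟨R (ψ : H), h⟩ : H) = R (T ψ)

/-- `A = f₀(T)`: the operator with domain `C*_c(S)H` determined by
`f₀(T) h(T)ψ = (fh)(T)ψ` for `h ∈ C_c(σ(T))` (where `σT` is the spectrum of `T`,
and `h(T) = (h∘u)(S)`). -/
def IsF0 (S : H →L[ℂ] H) (σT : Set ℝ) (f : ℝ → ℂ) (A : H →ₗ.[ℂ] H) : Prop :=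
  A.domain = ccSpan S ∧
  ∀ h : ℝ → ℂ, MemCc h σT → ∀ ψ : H,
    ∃ hm : pmapCalc S h ψ ∈ A.domain,
      A ⟨pmapCalc S h ψ, hm⟩ = pmapCalc S (fun x => f x * h x) ψ

open scoped InnerProductSpace

/-- The inverse `y ↦ y(1 + y²)^{-1/2}` of `uFun`. -/
def vFun : ℝ → ℝ := fun y => y / Real.sqrt (1 + y ^ 2)

theorem sqrt_one_sub_sq_pos {x : ℝ} (hx : x ∈ Set.Ioo (-1 : ℝ) 1) : 0 < √(1 - x ^ 2) :=
  Real.sqrt_pos.2 (by nlinarith [hx.1, hx.2])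

theorem continuousOn_uFun : ContinuousOn uFun (Set.Ioo (-1) 1) :=
  continuousOn_id.div (by fun_prop) fun _ hx => (sqrt_one_sub_sq_pos hx).ne'

theorem sqrt_one_add_sq_pos (y : ℝ) : 0 < √(1 + y ^ 2) := Real.sqrt_pos.2 (by positivity)

theorem continuous_vFun : Continuous vFun :=
  continuous_id.div (by fun_prop) fun y => (sqrt_one_add_sq_pos y).ne'

theorem one_sub_vFun_sq (y : ℝ) : 1 - vFun y ^ 2 = (√(1 + y ^ 2))⁻¹ ^ 2 := by
  have h := sqrt_one_add_sq_pos y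
  have h2 : √(1 + y ^ 2) ^ 2 = 1 + y ^ 2 := Real.sq_sqrt (by positivity)
  rw [vFun]
  field_simp
  linarith

theorem vFun_mem_Ioo (y : ℝ) : vFun y ∈ Set.Ioo (-1 : ℝ) 1 := by
  have h : 0 < 1 - vFun y ^ 2 := by
    rw [one_sub_vFun_sq]
    have := sqrt_one_add_sq_pos y
    positivity
  exact ⟨by nlinarith, by nlinarith⟩

theorem uFun_vFun (y : ℝ) : uFun (vFun y) = y := by
  have h := sqrt_one_add_sq_pos y
  rw [uFun, one_sub_vFun_sq, Real.sqrt_sq (by positivity), vFun]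
  field_simp

theorem vFun_uFun {x : ℝ} (hx : x ∈ Set.Ioo (-1 : ℝ) 1) : vFun (uFun x) = x := by
  have h := sqrt_one_sub_sq_pos hx
  have h2 : √(1 - x ^ 2) ^ 2 = 1 - x ^ 2 := Real.sq_sqrt (by nlinarith [hx.1, hx.2])
  have h3 : 1 + uFun x ^ 2 = (√(1 - x ^ 2))⁻¹ ^ 2 := by
    rw [uFun]
    field_simp
    linarith
  rw [vFun, h3, Real.sqrt_sq (by positivity), uFun]
  field_simp

theorem sub_mul_sqrt_eq_zero_iff {x : ℝ} (hx : 0 ≤ 1 - x ^ 2) (y : ℝ) :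
    x - y * √(1 - x ^ 2) = 0 ↔ x = vFun y := by
  rcases hx.eq_or_lt with h0 | hlt
  · rw [← h0, Real.sqrt_zero, mul_zero, sub_zero]
    refine ⟨fun h => ?_, fun h => ?_⟩
    · rw [h] at h0
      norm_num at h0
    · have := vFun_mem_Ioo y
      rw [← h] at this
      nlinarith [this.1, this.2]
  · have hmem : x ∈ Set.Ioo (-1 : ℝ) 1 := ⟨by nlinarith, by nlinarith⟩
    have hpos := sqrt_one_sub_sq_pos hmem
    have : x - y * √(1 - x ^ 2) = 0 ↔ uFun x = y := by
      rw [uFun, div_eq_iff hpos.ne', sub_eq_zero]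
    rw [this]
    exact ⟨fun h => by rw [← h, vFun_uFun hmem], fun h => by rw [h, uFun_vFun]⟩

theorem compU_apply {x : ℝ} (hx : x ∈ Set.Ioo (-1 : ℝ) 1) (f : ℝ → ℂ) :
    compU f x = f (uFun x) := if_pos hx

theorem compU_of_notMem {x : ℝ} (hx : x ∉ Set.Ioo (-1 : ℝ) 1) (f : ℝ → ℂ) :
    compU f x = 0 := if_neg hx

theorem compU_vFun (f : ℝ → ℂ) (y : ℝ) : compU f (vFun y) = f y := by
  rw [compU_apply (vFun_mem_Ioo y), uFun_vFun]

theorem compU_add (f g : ℝ → ℂ) :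
    compU (fun x => f x + g x) = fun x => compU f x + compU g x := by
  funext x
  simp only [compU]
  split_ifs <;> simp

theorem compU_mul (f g : ℝ → ℂ) :
    compU (fun x => f x * g x) = fun x => compU f x * compU g x := by
  funext x
  simp only [compU]
  split_ifs <;> simp

theorem compU_const_mul (c : ℂ) (f : ℝ → ℂ) :
    compU (fun x => c * f x) = fun x => c * compU f x := by
  funext x
  simp only [compU]
  split_ifs <;> simp

theorem compU_conj (f : ℝ → ℂ) :
    compU (fun x => starRingEnd ℂ (f x)) = fun x => starRingEnd ℂ (compU f x) := by
  funext x
  simp only [compU]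
  split_ifs <;> simp

/-- A function in `C₀` of a relatively open subset of `s` is continuous on all of `s`. -/
theorem MemC0.continuousOn_of_inter {g : ℝ → ℂ} {s U : Set ℝ} (hU : IsOpen U)
    (hg : MemC0 g (s ∩ U)) : ContinuousOn g s := by
  obtain ⟨hc, h0, hK⟩ := hg
  intro x hx
  by_cases hxU : x ∈ U
  · exact (hc x ⟨hx, hxU⟩).mono_of_mem_nhdsWithin
      (Filter.inter_mem self_mem_nhdsWithin (mem_nhdsWithin_of_mem_nhds (hU.mem_nhds hxU)))
  · rw [ContinuousWithinAt, h0 x fun h => hxU h.2, Metric.tendsto_nhds]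
    intro ε hε
    obtain ⟨K, hKc, hKs, hKε⟩ := hK ε hε
    have : Kᶜ ∈ nhdsWithin x s := mem_nhdsWithin_of_mem_nhds
      (hKc.isClosed.isOpen_compl.mem_nhds fun h => hxU (hKs h).2)
    filter_upwards [this] with y hy
    rw [dist_zero_right]
    by_cases hys : y ∈ s ∩ U
    · exact hKε y ⟨hys, hy⟩
    · rwa [h0 y hys, norm_zero]

theorem MemC0.compU {f : ℝ → ℂ} {s : Set ℝ} (hf : MemC0 f (vFun ⁻¹' s)) :
    MemC0 (compU f) (s ∩ Set.Ioo (-1) 1) := by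
  obtain ⟨hc, h0, hK⟩ := hf
  have hmaps : Set.MapsTo uFun (s ∩ Set.Ioo (-1) 1) (vFun ⁻¹' s) := fun x hx => by
    rw [Set.mem_preimage, vFun_uFun hx.2]
    exact hx.1
  refine ⟨(hc.comp (continuousOn_uFun.mono Set.inter_subset_right) hmaps).congr
    fun x hx => compU_apply hx.2 f, fun x hx => ?_, fun ε hε => ?_⟩
  · by_cases hxI : x ∈ Set.Ioo (-1 : ℝ) 1
    · rw [compU_apply hxI]
      refine h0 _ fun h => hx ⟨?_, hxI⟩
      rwa [Set.mem_preimage, vFun_uFun hxI] at h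
    · exact compU_of_notMem hxI f
  · obtain ⟨K, hKc, hKs, hKε⟩ := hK ε hε
    refine ⟨vFun '' K, hKc.image continuous_vFun, ?_, fun x hx => ?_⟩
    · rintro _ ⟨y, hy, rfl⟩
      exact ⟨hKs hy, vFun_mem_Ioo y⟩
    · rw [compU_apply hx.1.2]
      exact hKε _ ⟨hmaps hx.1, fun h => hx.2 ⟨_, h, vFun_uFun hx.1.2⟩⟩

theorem MemC0.comp_vFun {g : ℝ → ℂ} {s : Set ℝ} (hg : MemC0 g (s ∩ Set.Ioo (-1) 1)) :
    MemC0 (g ∘ vFun) (vFun ⁻¹' s) := by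
  obtain ⟨hc, h0, hK⟩ := hg
  have hmaps : Set.MapsTo vFun (vFun ⁻¹' s) (s ∩ Set.Ioo (-1) 1) :=
    fun y hy => ⟨hy, vFun_mem_Ioo y⟩
  refine ⟨hc.comp continuous_vFun.continuousOn hmaps, fun y hy => h0 _ fun h => hy h.1,
    fun ε hε => ?_⟩
  obtain ⟨K, hKc, hKs, hKε⟩ := hK ε hε
  refine ⟨uFun '' K, hKc.image_of_continuousOn
    (continuousOn_uFun.mono fun x hx => (hKs hx).2), ?_, fun y hy => ?_⟩
  · rintro _ ⟨x, hx, rfl⟩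
    rw [Set.mem_preimage, vFun_uFun (hKs hx).2]
    exact (hKs hx).1
  · exact hKε _ ⟨hmaps hy.1, fun h => hy.2 ⟨_, h, uFun_vFun y⟩⟩

theorem compU_comp_vFun {g : ℝ → ℂ} {s : Set ℝ} (hg : MemC0 g (s ∩ Set.Ioo (-1) 1)) :
    compU (g ∘ vFun) = g := by
  funext x
  by_cases hx : x ∈ Set.Ioo (-1 : ℝ) 1
  · rw [compU_apply hx, Function.comp_apply, vFun_uFun hx]
  · rw [compU_of_notMem hx, hg.2.1 x fun h => hx h.2]

section BoundedCalc

variable {S : H →L[ℂ] H}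

theorem re_mem_spectrum (hS : IsSelfAdjoint S) {z : ℂ} (hz : z ∈ spectrum ℂ S) :
    z.re ∈ spectrum ℝ S := hS.spectrumRestricts.apply_mem hz

theorem continuousOn_comp_re (hS : IsSelfAdjoint S) {g : ℝ → ℂ}
    (hg : ContinuousOn g (spectrum ℝ S)) :
    ContinuousOn (fun z : ℂ => g z.re) (spectrum ℂ S) :=
  hg.comp Complex.continuous_re.continuousOn fun _ hz => re_mem_spectrum hS hz

theorem norm_le_norm_boundedCalc (hS : IsSelfAdjoint S) {g : ℝ → ℂ}
    (hg : ContinuousOn g (spectrum ℝ S)) {x : ℝ} (hx : x ∈ spectrum ℝ S) :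
    ‖g x‖ ≤ ‖boundedCalc S g‖ := by
  have hz : (x : ℂ) ∈ spectrum ℂ S := by
    rw [← hS.spectrumRestricts.algebraMap_image]
    exact ⟨x, hx, rfl⟩
  simpa [boundedCalc] using norm_apply_le_norm_cfc (fun z : ℂ => g z.re) S hz
    (continuousOn_comp_re hS hg) hS.isStarNormal

theorem norm_boundedCalc_le (hS : IsSelfAdjoint S) {g : ℝ → ℂ} {c : ℝ} (hc : 0 ≤ c)
    (h : ∀ x ∈ spectrum ℝ S, ‖g x‖ ≤ c) : ‖boundedCalc S g‖ ≤ c :=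
  norm_cfc_le hc fun _ hz => h _ (re_mem_spectrum hS hz)

end BoundedCalc

section BoundedTransform

variable {T : H →ₗ.[ℂ] H} {S : H →L[ℂ] H}

theorem inner_apply_left_of_isSelfAdjoint (hsa : IsSelfAdjoint T) (x y : T.domain) :
    ⟪T x, (y : H)⟫_ℂ = ⟪(x : H), T y⟫_ℂ := by
  have h := LinearPMap.adjoint_isFormalAdjoint (𝕜 := ℂ) hsa.dense_domain
  rw [LinearPMap.isSelfAdjoint_def.1 hsa] at h
  exact h x y

/-- The structure of the bounded transform: it is self-adjoint, `(I + T²)⁻¹ = I - S²` and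
`T = S(I - S²)^{-1/2}` with `(I - S²)^{1/2}` injective. -/
theorem IsBoundedTransform.exists_sqrt (hsa : IsSelfAdjoint T) (hbt : IsBoundedTransform T S) :
    IsSelfAdjoint S ∧ ∃ R : H →L[ℂ] H, R.IsPositive ∧ R * R = 1 - S * S ∧
      Function.Injective R ∧
      (∀ x : H, ∃ hx : R x ∈ T.domain, (T ⟨R x, hx⟩ : H) = S x) ∧
      ∀ ψ : T.domain, ∃ x : H, R x = ψ := by
  obtain ⟨C, R, hC, hR, hRC, hCT, hRT⟩ := hbt
  have sym : ∀ (x y : H) (hx : x ∈ T.domain) (hy : y ∈ T.domain),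
      ⟪T ⟨x, hx⟩, y⟫_ℂ = ⟪x, T ⟨y, hy⟩⟫_ℂ :=
    fun x y hx hy => inner_apply_left_of_isSelfAdjoint hsa ⟨x, hx⟩ ⟨y, hy⟩
  have hRsym : ∀ x y, ⟪R x, y⟫_ℂ = ⟪x, R y⟫_ℂ := hR.isSymmetric
  have hCsym : ∀ x y, ⟪C x, y⟫_ℂ = ⟪x, C y⟫_ℂ := hC.isSymmetric
  have hRR : ∀ x, R (R x) = C x := fun x => DFunLike.congr_fun hRC x
  choose hRd hST using hRT
  have hTC : ∀ x (h : C x ∈ T.domain), T ⟨C x, h⟩ = S (R x) := by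
    intro x h
    rw [hST (R x)]
    congr 2
    exact (hRR x).symm
  have hCT' : ∀ x, ∃ h : S (R x) ∈ T.domain, C x + T ⟨S (R x), h⟩ = x := by
    intro x
    obtain ⟨h1, h2, h3⟩ := hCT x
    have e := hTC x h1
    refine ⟨e ▸ h2, ?_⟩
    convert h3 using 4
    exact e.symm
  have hCd : ∀ x, C x ∈ T.domain := fun x => hRR x ▸ hRd (R x)
  choose hSRd hTT using hCT'
  have hCinj : ∀ x, C x = 0 → x = 0 := by
    intro x hx
    have h1 : S (R x) = 0 := by
      rw [← hTC x (hCd x)]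
      have : (⟨C x, hCd x⟩ : T.domain) = 0 := Subtype.ext hx
      rw [this, LinearPMap.map_zero]
    have h2 := hTT x
    have : (⟨S (R x), hSRd x⟩ : T.domain) = 0 := Subtype.ext h1
    rw [this, LinearPMap.map_zero, hx, add_zero] at h2
    exact h2.symm
  have hRinj : Function.Injective R := by
    refine (injective_iff_map_eq_zero R).2 fun x hx => hCinj x ?_
    rw [← hRR, hx, map_zero]
  have hBsym : ∀ x y, ⟪S (R x), y⟫_ℂ = ⟪x, S (R y)⟫_ℂ := by
    intro x y
    have e1 : ⟪S (R x), C y⟫_ℂ = ⟪C x, S (R y)⟫_ℂ := by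
      rw [← hTC x (hCd x), ← hTC y (hCd y), sym]
    have e2 : ⟪S (R x), T ⟨S (R y), hSRd y⟩⟫_ℂ = ⟪T ⟨S (R x), hSRd x⟩, S (R y)⟫_ℂ :=
      (sym _ _ _ _).symm
    conv_lhs => rw [← hTT y]
    conv_rhs => rw [← hTT x]
    rw [inner_add_right, inner_add_left, e1, e2]
  have hCcomm : ∀ ψ : T.domain, C (T ψ) = S (R ψ) := by
    intro ψ
    refine ext_inner_right ℂ fun y => ?_
    rw [hCsym, hBsym, ← hTC y (hCd y)]
    exact sym _ _ _ _
  have hCB : Commute C (S * R) := by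
    ext x
    change C (S (R x)) = S (R (C x))
    rw [← hTC x (hCd x), hCcomm]
  have hRB : Commute R (S * R) := by
    have h0 : 0 ≤ R := (ContinuousLinearMap.nonneg_iff_isPositive R).2 hR
    have := hCB.cfcₙ_nnreal NNReal.sqrt
    rw [← CFC.sqrt, CFC.sqrt_unique hRC h0] at this
    exact this
  have hRsa : star R = R := hR.isSelfAdjoint
  have hcancel : ∀ D : H →L[ℂ] H, R * D = 0 → D = 0 := fun D hD => by
    ext x
    exact hRinj ((DFunLike.congr_fun hD x).trans (map_zero R).symm)
  have hSR : R * S = S * R := by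
    have h0 : (R * S - S * R) * R = 0 := by
      rw [sub_mul, sub_eq_zero, mul_assoc]
      exact hRB
    have h1 : R * star (R * S - S * R) = 0 := by
      have := congrArg star h0
      rwa [star_mul, hRsa, star_zero] at this
    exact sub_eq_zero.1 (star_eq_zero.1 (hcancel _ h1))
  have hBsa : star (S * R) = S * R := by
    rw [ContinuousLinearMap.star_eq_adjoint]
    exact ((ContinuousLinearMap.eq_adjoint_iff _ _).2 hBsym).symm
  have hSsa : star S = S := by
    refine sub_eq_zero.1 (hcancel _ ?_)
    rw [mul_sub, hSR, sub_eq_zero, ← hBsa, star_mul, hRsa]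
  have hSR' : ∀ x, R (S x) = S (R x) := fun x => DFunLike.congr_fun hSR x
  have hTS : ∀ x (h : S (R x) ∈ T.domain), T ⟨S (R x), h⟩ = S (S x) := by
    intro x h
    rw [hST (S x)]
    congr 2
    exact (hSR' x).symm
  have hCS : ∀ x, C x + S (S x) = x := fun x => by
    rw [← hTS x (hSRd x), hTT]
  have hSsym : ∀ x y, ⟪S x, y⟫_ℂ = ⟪x, S y⟫_ℂ :=
    (ContinuousLinearMap.isSelfAdjoint_iff_isSymmetric.1 hSsa)
  refine ⟨hSsa, R, hR, ?_, hRinj, fun x => ⟨hRd x, (hST x).symm⟩, fun ψ =>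
    ⟨R ψ + S (T ψ), ?_⟩⟩
  · rw [hRC, eq_sub_iff_add_eq]
    ext x
    exact hCS x
  · have hRT : R (T ψ) = S ψ := by
      refine ext_inner_right ℂ fun y => ?_
      rw [hRsym, hSsym, hST y]
      exact sym _ _ _ _
    rw [map_add, hRR, hSR', hRT, hCS]

/-- The real spectrum of `T` corresponds to `σ(S) ∩ (-1,1)` under the inverse of `u`. -/
theorem IsBoundedTransform.realSpec_eq (hsa : IsSelfAdjoint T) (hbt : IsBoundedTransform T S) :
    realSpec T = vFun ⁻¹' spectrum ℝ S := by
  obtain ⟨hS, R, hR, hRR, hRinj, hRT, hdom⟩ := hbt.exists_sqrt hsa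
  have hcfc : cfc (fun x : ℝ => 1 - x ^ 2) S = R * R := by
    rw [hRR, cfc_sub (fun _ => (1 : ℝ)) (fun x => x ^ 2) S, cfc_const_one ℝ S,
      cfc_pow_id (R := ℝ) S 2, sq]
  have hR0 : 0 ≤ R := (ContinuousLinearMap.nonneg_iff_isPositive R).2 hR
  have hnonneg : ∀ x ∈ spectrum ℝ S, 0 ≤ 1 - x ^ 2 := by
    rw [← cfc_nonneg_iff (fun x : ℝ => 1 - x ^ 2) S, hcfc]
    exact hR0.isSelfAdjoint.mul_self_nonneg
  have hRcfc : cfc (fun x : ℝ => √(1 - x ^ 2)) S = R := by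
    rw [← CFC.mul_self_eq_mul_self_iff _ _ (cfc_nonneg fun x _ => Real.sqrt_nonneg _) hR0, ← hcfc,
      ← cfc_mul (fun x : ℝ => √(1 - x ^ 2)) (fun x : ℝ => √(1 - x ^ 2)) S]
    exact cfc_congr fun x hx => Real.mul_self_sqrt (hnonneg x hx)
  ext y
  have hA : cfc (fun x : ℝ => x - y * √(1 - x ^ 2)) S = S - y • R := by
    rw [cfc_sub (fun x : ℝ => x) (fun x => y * √(1 - x ^ 2)) S, cfc_id' ℝ S,
      cfc_const_mul y (fun x : ℝ => √(1 - x ^ 2)) S, hRcfc]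
  have hunit : IsUnit (S - y • R) ↔ vFun y ∉ spectrum ℝ S := by
    rw [← hA, isUnit_cfc_iff (fun x : ℝ => x - y * √(1 - x ^ 2)) S]
    refine ⟨fun h hy => h _ hy ((sub_mul_sqrt_eq_zero_iff (hnonneg _ hy) y).2 rfl),
      fun h x hx h0 => h ?_⟩
    rwa [← (sub_mul_sqrt_eq_zero_iff (hnonneg _ hx) y).1 h0]
  choose hRd hTR using hRT
  have hAapp : ∀ x, (S - y • R) x = T ⟨R x, hRd x⟩ - (y : ℂ) • R x := fun x => by
    rw [hTR]
    simp
  rw [Set.mem_preimage, ← not_iff_not, ← hunit]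
  change ¬ ¬ _ ↔ _
  rw [not_not]
  constructor
  · rintro ⟨B, hB1, hB2⟩
    rw [ContinuousLinearMap.isUnit_iff_bijective]
    refine ⟨(injective_iff_map_eq_zero _).2 fun x hx => hRinj ?_, fun x => ?_⟩
    · have := hB2 ⟨R x, hRd x⟩
      rw [← hAapp, hx, map_zero] at this
      rw [map_zero]
      exact this.symm
    · obtain ⟨h, hx⟩ := hB1 x
      obtain ⟨w, hw⟩ := hdom ⟨B x, h⟩
      refine ⟨w, ?_⟩
      rw [hAapp, ← hx]
      congr 3
  · rintro ⟨A, hA⟩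
    have h1 : ∀ x, (S - y • R) ((↑A⁻¹ : H →L[ℂ] H) x) = x := fun x => by
      rw [← hA]
      exact DFunLike.congr_fun A.mul_inv x
    have h2 : ∀ x, (↑A⁻¹ : H →L[ℂ] H) ((S - y • R) x) = x := fun x => by
      rw [← hA]
      exact DFunLike.congr_fun A.inv_mul x
    refine ⟨R * ↑A⁻¹, fun x => ⟨hRd _, ?_⟩, fun ψ => ?_⟩
    · exact (hAapp _).symm.trans (h1 x)
    · obtain ⟨w, hw⟩ := hdom ψ
      obtain rfl : ⟨R w, hRd w⟩ = ψ := Subtype.ext hw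
      rw [← hAapp]
      exact congrArg R (h2 w)

end BoundedTransform

/-- The map `f ↦ f(T) = (f∘u)(S)` is an isometric *-homomorphism from `C₀(σ(T))` into the
unital C*-algebra `C*(S)` generated by `S`, with image `C*₀(S) = { g(S) : g ∈ C₀(σ̃(S)) }`. -/
theorem c0_calc_isometric_starHom (T : H →ₗ.[ℂ] H) (S : H →L[ℂ] H)
    (hdense : Dense (T.domain : Set H)) (hsa : IsSelfAdjoint T)
    (hbt : IsBoundedTransform T S) :
    (∀ f g : ℝ → ℂ, MemC0 f (realSpec T) → MemC0 g (realSpec T) →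
      pmapCalc S (fun x => f x + g x) = pmapCalc S f + pmapCalc S g ∧
      pmapCalc S (fun x => f x * g x) = pmapCalc S f * pmapCalc S g) ∧
    (∀ f : ℝ → ℂ, MemC0 f (realSpec T) → ∀ c : ℂ,
      pmapCalc S (fun x => c * f x) = c • pmapCalc S f) ∧
    (∀ f : ℝ → ℂ, MemC0 f (realSpec T) →
      pmapCalc S (fun x => starRingEnd ℂ (f x)) = star (pmapCalc S f)) ∧
    (∀ f : ℝ → ℂ, MemC0 f (realSpec T) →
      ‖pmapCalc S f‖ = supNorm f (realSpec T)) ∧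
    (∀ f : ℝ → ℂ, MemC0 f (realSpec T) →
      pmapCalc S f ∈ StarAlgebra.elemental ℂ S) ∧
    ({B : H →L[ℂ] H | ∃ f : ℝ → ℂ, MemC0 f (realSpec T) ∧ B = pmapCalc S f} =
      {B : H →L[ℂ] H | ∃ g : ℝ → ℂ, MemC0 g (tildeSpec S) ∧ B = boundedCalc S g}) := by
  have hS : IsSelfAdjoint S := (hbt.exists_sqrt hsa).1
  have hspec := hbt.realSpec_eq hsa
  have hcont : ∀ f : ℝ → ℂ, MemC0 f (realSpec T) → ContinuousOn (compU f) (spectrum ℝ S) :=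
    fun f hf => (MemC0.compU (hspec ▸ hf)).continuousOn_of_inter isOpen_Ioo
  have hcont' : ∀ f : ℝ → ℂ, MemC0 f (realSpec T) →
      ContinuousOn (fun z : ℂ => compU f z.re) (spectrum ℂ S) :=
    fun f hf => continuousOn_comp_re hS (hcont f hf)
  refine ⟨fun f g hf hg => ⟨?_, ?_⟩, fun f hf c => ?_, fun f hf => ?_, fun f hf => ?_,
    fun f hf => cfc_mem_elemental _ S, ?_⟩
  · rw [pmapCalc, boundedCalc, compU_add]
    exact cfc_add S _ _ (hcont' f hf) (hcont' g hg)
  · rw [pmapCalc, boundedCalc, compU_mul]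
    exact cfc_mul _ _ S (hcont' f hf) (hcont' g hg)
  · rw [pmapCalc, boundedCalc, compU_const_mul]
    exact cfc_const_mul c _ S (hcont' f hf)
  · rw [pmapCalc, boundedCalc, compU_conj]
    exact cfc_star _ S
  · have hle : ∀ y ∈ realSpec T, ‖f y‖ ≤ ‖pmapCalc S f‖ := fun y hy => by
      rw [hspec] at hy
      rw [← compU_vFun f y]
      exact norm_le_norm_boundedCalc hS (hcont f hf) hy
    refine le_antisymm (norm_boundedCalc_le hS (Real.sSup_nonneg ?_) fun x hx => ?_)
      (Real.sSup_le ?_ (norm_nonneg _))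
    · rintro _ ⟨y, -, rfl⟩
      exact norm_nonneg _
    · by_cases hxI : x ∈ Set.Ioo (-1 : ℝ) 1
      · rw [compU_apply hxI]
        refine le_csSup ⟨‖pmapCalc S f‖, ?_⟩ ⟨uFun x, ?_, rfl⟩
        · rintro _ ⟨y, hy, rfl⟩
          exact hle y hy
        · rwa [hspec, Set.mem_preimage, vFun_uFun hxI]
      · rw [compU_of_notMem hxI, norm_zero]
        refine Real.sSup_nonneg ?_
        rintro _ ⟨y, -, rfl⟩
        exact norm_nonneg _
    · rintro _ ⟨y, hy, rfl⟩
      exact hle y hy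
  · ext B
    constructor
    · rintro ⟨f, hf, rfl⟩
      exact ⟨compU f, MemC0.compU (hspec ▸ hf), rfl⟩
    · rintro ⟨g, hg, rfl⟩
      refine ⟨g ∘ vFun, hspec ▸ MemC0.comp_vFun hg, ?_⟩
      rw [pmapCalc, compU_comp_vFun hg]
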